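/- arXiv:2403.07484 — 3 statements merged into one kernel-verified Lean document; each statement's English description precedes it below -/
import Mathlib

section
/- If a free filter F on ω does not have the Nikodym property, then there is an anti-Nikodym sequence (μ_n) of finitely supported signed measures on N_F which is disjointly supported, i.e., supp(μ_k) ∩ supp(μ_l) = ∅ for all k ≠ l. -/
open Filter Topology Set MeasureTheory
open scoped ENNReal NNReal

noncomputable section

/-- The space `N_F = ℕ ∪ {p_F}`, modelled as `Option ℕ` with `none` playing the role of `p_F`:
every natural number (i.e. `some n`) is isolated, and a set containing `none` is open iff its
trace on `ℕ` belongs to `F`. -/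
def NFTop (F : Filter ℕ) : TopologicalSpace (Option ℕ) where
  IsOpen U := none ∈ U → {n : ℕ | some n ∈ U} ∈ F
  isOpen_univ := fun _ => Filter.univ_mem
  isOpen_inter := fun U V hU hV h => Filter.inter_mem (hU h.1) (hV h.2)
  isOpen_sUnion := fun S hS h => by
    obtain ⟨U, hUS, hU⟩ := h
    exact Filter.mem_of_superset (hS U hUS hU) fun n hn => ⟨U, hUS, hn⟩

/-- A finitely supported signed measure on `N_F` is modelled as a finitely supported
function `Option ℕ →₀ ℝ`; its value on a set `A` is the sum of its weights on `A`. -/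
def fsMeas (μ : Option ℕ →₀ ℝ) (A : Set (Option ℕ)) : ℝ :=
  ∑ x ∈ μ.support, A.indicator (fun y => μ y) x

/-- The norm `‖μ‖ = Σ |α_i|` of a finitely supported signed measure. -/
def fsNorm (μ : Option ℕ →₀ ℝ) : ℝ :=
  ∑ x ∈ μ.support, |μ x|

/-- `‖μ ↾ B‖`, the variation of `μ` on a set `B`. -/
def fsRestrNorm (μ : Option ℕ →₀ ℝ) (B : Set (Option ℕ)) : ℝ :=
  ∑ x ∈ μ.support, B.indicator (fun y => |μ y|) x

/-- The integral `∫ f dμ` of a function against a finitely supported signed measure. -/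
def fsInteg (μ : Option ℕ →₀ ℝ) (f : Option ℕ → ℝ) : ℝ :=
  ∑ x ∈ μ.support, μ x * f x

/-- An anti-Nikodym sequence on `N_F`: `‖μ_n‖ → ∞` and `μ_n(A) → 0` for every clopen `A`. -/
def IsANSeq (F : Filter ℕ) (μ : ℕ → (Option ℕ →₀ ℝ)) : Prop :=
  Tendsto (fun n => fsNorm (μ n)) atTop atTop ∧
    ∀ A : Set (Option ℕ), @IsClopen _ (NFTop F) A →
      Tendsto (fun n => fsMeas (μ n) A) atTop (nhds 0)

/-- A free filter `F` has the Nikodym property if there is no anti-Nikodym sequence on `N_F`. -/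
def HasNikodymProp (F : Filter ℕ) : Prop :=
  ¬ ∃ μ : ℕ → (Option ℕ →₀ ℝ), IsANSeq F μ

/-- A finitely supported (nonnegative) measure on `ℕ`, evaluated on a set `A ⊆ ℕ`. -/
def natMeas (μ : ℕ →₀ ℝ) (A : Set ℕ) : ℝ :=
  ∑ x ∈ μ.support, A.indicator (fun y => μ y) x

/-- The norm of a finitely supported measure on `ℕ`. -/
def natNorm (μ : ℕ →₀ ℝ) : ℝ :=
  ∑ x ∈ μ.support, |μ x|

/-- `at⁺(μ)`: the largest atom of a finitely supported measure on `ℕ`. -/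
def atPlus (μ : ℕ →₀ ℝ) : ℝ := sSup ((fun x => μ x) '' ↑μ.support)

/-- `at⁻(μ)`: the smallest atom of a finitely supported measure on `ℕ`. -/
def atMinus (μ : ℕ →₀ ℝ) : ℝ := sInf ((fun x => μ x) '' ↑μ.support)

/-- A submeasure on `ω`. -/
structure Submeasure where
  toFun : Set ℕ → ℝ≥0∞
  empty' : toFun ∅ = 0
  finite_singleton' : ∀ n : ℕ, toFun {n} ≠ ⊤
  mono' : ∀ ⦃A B : Set ℕ⦄, A ⊆ B → toFun A ≤ toFun B
  subadd' : ∀ A B : Set ℕ, toFun (A ∪ B) ≤ toFun A + toFun B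

/-- Lower semicontinuity of a submeasure: `φ(A) = lim_n φ(A ∩ [0,n])`. -/
def Submeasure.LSC (φ : Submeasure) : Prop :=
  ∀ A : Set ℕ, Tendsto (fun n : ℕ => φ.toFun (A ∩ Set.Iic n)) atTop (nhds (φ.toFun A))

/-- The exhaustive ideal `Exh(φ) = {A : lim_n φ(A ∖ [0,n]) = 0}` of a submeasure. -/
def Exh (φ : Submeasure) : Set (Set ℕ) :=
  {A : Set ℕ | Tendsto (fun n : ℕ => φ.toFun (A \ Set.Iic n)) atTop (nhds 0)}

/-- A density submeasure: `φ = sup_n μ_n` for a sequence of finitely supported nonnegative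
measures on `ℕ` with pairwise disjoint supports. -/
def Submeasure.IsDensity (φ : Submeasure) : Prop :=
  ∃ μ : ℕ → (ℕ →₀ ℝ), (∀ n x, 0 ≤ μ n x) ∧
    (∀ m n, m ≠ n → Disjoint (μ m).support (μ n).support) ∧
    ∀ A : Set ℕ, φ.toFun A = ⨆ n : ℕ, ENNReal.ofReal (natMeas (μ n) A)

/-- A non-pathological submeasure: `φ(A)` is the supremum of `μ(A)` over all nonnegative
(σ-additive) measures `μ` on `ℕ` dominated by `φ`. -/
def Submeasure.Nonpathological (φ : Submeasure) : Prop :=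
  ∀ A : Set ℕ,
    φ.toFun A =
      ⨆ (w : ℕ → ℝ≥0∞) (_ : ∀ B : Set ℕ, ∑' n : B, w n ≤ φ.toFun B), ∑' n : A, w n

/-- An ideal on `ω`: contains all finite sets, closed under subsets and finite unions,
and does not contain `ℕ` itself. -/
def IsIdeal (I : Set (Set ℕ)) : Prop :=
  (∀ A : Set ℕ, A.Finite → A ∈ I) ∧
    (∀ A B : Set ℕ, A ⊆ B → B ∈ I → A ∈ I) ∧
    (∀ A B : Set ℕ, A ∈ I → B ∈ I → A ∪ B ∈ I) ∧
    Set.univ ∉ I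

/-- The Katětov order on families of subsets of `ℕ`. -/
def KatLE (I J : Set (Set ℕ)) : Prop :=
  ∃ f : ℕ → ℕ, ∀ A ∈ I, f ⁻¹' A ∈ J

/-- The dual filter `I*` of an ideal `I` (as a `Filter`; when `I` is an ideal, this filter's
sets are exactly the complements of members of `I`). -/
def dualFilter (I : Set (Set ℕ)) : Filter ℕ :=
  Filter.generate {A : Set ℕ | Aᶜ ∈ I}

/-- The class `AN` of all ideals on `ω` whose dual filters do not have the Nikodym property. -/
def ANclass : Set (Set (Set ℕ)) :=
  {I | IsIdeal I ∧ ¬ HasNikodymProp (dualFilter I)}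

/-- A density ideal: `Exh(sup_n μ_n)` for a disjointly supported sequence of finitely
supported nonnegative measures on `ℕ`. -/
def IsDensityIdeal (I : Set (Set ℕ)) : Prop :=
  ∃ μ : ℕ → (ℕ →₀ ℝ), (∀ n x, 0 ≤ μ n x) ∧
    (∀ m n, m ≠ n → Disjoint (μ m).support (μ n).support) ∧
    I = {A : Set ℕ |
      Tendsto (fun m : ℕ => ⨆ n : ℕ, ENNReal.ofReal (natMeas (μ n) (A \ Set.Iic m)))
        atTop (nhds 0)}

/-- The asymptotic density submeasure `φ_d(A) = sup_n |A ∩ [2^n, 2^{n+1})|/2^n`. -/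
def phid (A : Set ℕ) : ℝ≥0∞ :=
  ⨆ n : ℕ, ((A ∩ Set.Ico (2 ^ n) (2 ^ (n + 1))).ncard : ℝ≥0∞) / 2 ^ n

/-- The asymptotic density zero ideal `Z = Exh(φ_d)`. -/
def Zideal : Set (Set ℕ) :=
  {A : Set ℕ | Tendsto (fun m : ℕ => phid (A \ Set.Iic m)) atTop (nhds 0)}

/-- `Exh(sup_{n ≥ 1} ν_n)` for a sequence of finitely supported measures indexed by `n ≥ 1`. -/
def ExhSupPos (ν : ℕ → (ℕ →₀ ℝ)) : Set (Set ℕ) :=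
  {A : Set ℕ |
    Tendsto (fun m : ℕ => ⨆ n : ℕ, ENNReal.ofReal (natMeas (ν (n + 1)) (A \ Set.Iic m)))
      atTop (nhds 0)}

/-- `PhiStart f n` is the left endpoint of the interval `I_n` in the interval partition
associated with `f` (so `I_n = [PhiStart f n, PhiStart f (n+1))` has `n·f(n)` elements). -/
def PhiStart (f : ℕ → ℕ) (n : ℕ) : ℕ :=
  ∑ k ∈ Finset.range n, k * f k

/-- The density ideal `Φ(f) = Exh(sup_{n≥1} μ_n^f)`, where `μ_n^f` gives mass `1/f(n)` to each
point of the interval `I_n` (of size `n·f(n)`), so that `‖μ_n^f‖ = n`. -/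
def PhiIdeal (f : ℕ → ℕ) : Set (Set ℕ) :=
  {A : Set ℕ |
    Tendsto (fun m : ℕ => ⨆ n : ℕ,
        ENNReal.ofReal
          (((A \ Set.Iic m) ∩ Set.Ico (PhiStart f (n + 1)) (PhiStart f (n + 2))).ncard
            / f (n + 1)))
      atTop (nhds 0)}

/-- The dominating number `𝔡`. -/
def domNumber : Cardinal :=
  sInf {c : Cardinal | ∃ D : Set (ℕ → ℕ), Cardinal.mk D = c ∧
    ∀ g : ℕ → ℕ, ∃ f ∈ D, ∀ᶠ n in atTop, g n ≤ f n}

/-- The unbounding number `𝔟`. -/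
def unbNumber : Cardinal :=
  sInf {c : Cardinal | ∃ U : Set (ℕ → ℕ), Cardinal.mk U = c ∧
    ∀ g : ℕ → ℕ, ∃ f ∈ U, {n : ℕ | g n < f n}.Infinite}

/-- A P-ideal: every countable family in `J` has a pseudo-union in `J`. -/
def IsPIdeal (J : Set (Set ℕ)) : Prop :=
  ∀ A : ℕ → Set ℕ, (∀ n, A n ∈ J) → ∃ B ∈ J, ∀ n, (A n \ B).Finite

/-- The characteristic-function embedding of `P(ℕ)` into the Cantor space `2^ℕ`. -/
def chi (A : Set ℕ) : ℕ → Bool :=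
  fun n => @decide (n ∈ A) (Classical.propDecidable _)

end

theorem fsMeas_eq_sum_of_subset {μ : Option ℕ →₀ ℝ} {U : Finset (Option ℕ)}
    (hU : μ.support ⊆ U) (A : Set (Option ℕ)) :
    fsMeas μ A = ∑ x ∈ U, A.indicator (fun y => μ y) x := by
  refine Finset.sum_subset hU fun x _ hx => ?_
  rw [Finsupp.notMem_support_iff] at hx
  by_cases h : x ∈ A <;> simp [h, hx]

theorem fsNorm_eq_sum_of_subset {μ : Option ℕ →₀ ℝ} {U : Finset (Option ℕ)}
    (hU : μ.support ⊆ U) : fsNorm μ = ∑ x ∈ U, |μ x| := by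
  refine Finset.sum_subset hU fun x _ hx => ?_
  rw [Finsupp.notMem_support_iff] at hx
  simp [hx]

theorem sum_abs_le_fsNorm (μ : Option ℕ →₀ ℝ) (V : Finset (Option ℕ)) :
    ∑ x ∈ V, |μ x| ≤ fsNorm μ := by
  classical
  rw [fsNorm_eq_sum_of_subset (Finset.subset_union_left (s₂ := V))]
  exact Finset.sum_le_sum_of_subset_of_nonneg Finset.subset_union_right
    fun _ _ _ => abs_nonneg _

theorem isClopen_singleton_some {F : Filter ℕ} (hfree : F ≤ cofinite) (x : ℕ) :
    @IsClopen _ (NFTop F) {some x} := by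
  let := NFTop F
  refine ⟨⟨fun _ => ?_⟩, fun h => by simp at h⟩
  refine hfree ?_
  simp [Filter.mem_cofinite, Set.compl_def]

theorem IsANSeq.tendsto_apply_some {F : Filter ℕ} (hfree : F ≤ cofinite)
    {μ : ℕ → (Option ℕ →₀ ℝ)} (hμ : IsANSeq F μ) (x : ℕ) :
    Tendsto (fun n => μ n (some x)) atTop (𝓝 0) := by
  classical
  refine (hμ.2 _ (isClopen_singleton_some hfree x)).congr fun n => ?_
  rw [fsMeas_eq_sum_of_subset (Finset.subset_insert (some x) (μ n).support),
    Finset.sum_eq_single (some x)]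
  · simp
  · intro y _ hy
    simp [hy]
  · simp

theorem IsANSeq.tendsto_sum_abs {F : Filter ℕ} (hfree : F ≤ cofinite)
    {μ : ℕ → (Option ℕ →₀ ℝ)} (hμ : IsANSeq F μ) (S : Finset (Option ℕ)) :
    Tendsto (fun n => ∑ x ∈ S.erase none, |μ n x|) atTop (𝓝 0) := by
  rw [← Finset.sum_const_zero (s := S.erase none)]
  refine tendsto_finsetSum _ fun x hx => ?_
  obtain ⟨y, rfl⟩ := Option.ne_none_iff_exists'.1 (Finset.ne_of_mem_erase hx)
  simpa using (hμ.tendsto_apply_some hfree y).abs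

/-- The mass of an anti-Nikodym sequence on `ℕ` is unbounded. -/
theorem IsANSeq.tendsto_fsNorm_sub {F : Filter ℕ}
    {μ : ℕ → (Option ℕ →₀ ℝ)} (hμ : IsANSeq F μ) :
    Tendsto (fun n => fsNorm (μ n) - |μ n none|) atTop atTop := by
  classical
  have huniv : Tendsto (fun n => |fsMeas (μ n) Set.univ|) atTop (𝓝 0) := by
    simpa using (hμ.2 Set.univ (@isClopen_univ _ (NFTop F))).abs
  have hlow : ∀ n, fsNorm (μ n) - |fsMeas (μ n) Set.univ| ≤
      2 * (fsNorm (μ n) - |μ n none|) := by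
    intro n
    have hsub := Finset.subset_insert none (μ n).support
    have hmem := Finset.mem_insert_self none (μ n).support
    rw [fsMeas_eq_sum_of_subset hsub, fsNorm_eq_sum_of_subset hsub,
      ← Finset.add_sum_erase _ _ hmem, ← Finset.add_sum_erase _ _ hmem]
    simp only [Set.indicator_univ]
    set R := (insert none (μ n).support).erase none
    have h₁ := Finset.abs_sum_le_sum_abs (fun x => μ n x) R
    have h₂ := abs_sub (μ n none + ∑ x ∈ R, μ n x) (∑ x ∈ R, μ n x)
    rw [add_sub_cancel_right] at h₂
    linarith
  have h₂ : Tendsto (fun n => 2 * (fsNorm (μ n) - |μ n none|)) atTop atTop := by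
    refine tendsto_atTop_mono hlow ?_
    simpa [sub_eq_add_neg] using hμ.1.atTop_add huniv.neg
  exact (tendsto_const_mul_atTop_of_pos two_pos).1 h₂

theorem eventually_frequently_le_add {u : ℕ → ℝ} (hu : ∀ n, 0 ≤ u n) {ε : ℝ} (hε : 0 < ε) :
    ∀ᶠ n in atTop, ∃ᶠ m in atTop, u n ≤ u m + ε := by
  by_contra hcon
  simp only [not_eventually, not_frequently, not_le] at hcon
  let S : Set ℝ := {x | ∀ᶠ m in atTop, u m < x}
  have hbdd : BddBelow S := ⟨0, fun x hx => by
    obtain ⟨m, hm⟩ := Eventually.exists hx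
    exact (hu m).trans hm.le⟩
  have hS : ∀ n, (∀ᶠ m in atTop, u m + ε < u n) → u n - ε ∈ S := fun n hn =>
    hn.mono fun m hm => by linarith
  obtain ⟨n, hn⟩ := hcon.exists
  obtain ⟨x, hx, hxlt⟩ := exists_lt_of_csInf_lt ⟨_, hS n hn⟩ (lt_add_of_pos_right (sInf S) hε)
  obtain ⟨k, hk, hkx⟩ := (hcon.and_eventually hx).exists
  have := csInf_le hbdd (hS k hk)
  linarith

theorem exists_abs_le_one_abs_sub_mul_le {a b ε : ℝ} (hε : 0 ≤ ε) (h : |a| ≤ |b| + ε) :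
    ∃ c : ℝ, |c| ≤ 1 ∧ |a - c * b| ≤ ε := by
  rcases le_or_gt |a| |b| with hab | hab
  · rcases eq_or_ne b 0 with rfl | hb
    · exact ⟨0, by simp, by simpa using h⟩
    · refine ⟨a / b, ?_, by rwa [div_mul_cancel₀ _ hb, sub_self, abs_zero]⟩
      rw [abs_div]
      exact div_le_one_of_le₀ hab (abs_nonneg _)
  · have key : |(|a| - |b|)| ≤ ε := by
      rw [abs_of_pos (sub_pos.2 hab)]
      linarith
    rcases abs_choice a with ha | ha <;> rcases abs_choice b with hb | hb <;>
      rw [ha, hb] at key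
    · exact ⟨1, by simp, by simpa using key⟩
    · exact ⟨-1, by simp, by simpa using key⟩
    · refine ⟨-1, by simp, ?_⟩
      rw [← abs_neg]
      convert key using 2
      ring
    · refine ⟨1, by simp, ?_⟩
      rw [← abs_neg]
      convert key using 2
      ring

/-- `ν` is a measure of norm at least `k` whose values are controlled by those of two members of
`μ` of index at least `k`, up to `3 / (k + 1)`. -/
def IsControlled (μ : ℕ → (Option ℕ →₀ ℝ)) (k : ℕ) (ν : Option ℕ →₀ ℝ) : Prop :=
  (k : ℝ) ≤ fsNorm ν ∧ ∃ n m, k ≤ n ∧ k ≤ m ∧ ∀ A : Set (Option ℕ),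
    |fsMeas ν A| ≤ |fsMeas (μ n) A| + |fsMeas (μ m) A| + 3 * (1 / ((k : ℝ) + 1))

theorem IsANSeq.exists_isControlled_disjoint {F : Filter ℕ} (hfree : F ≤ cofinite)
    {μ : ℕ → (Option ℕ →₀ ℝ)} (hμ : IsANSeq F μ) (k : ℕ) (S : Finset (Option ℕ)) :
    ∃ ν, IsControlled μ k ν ∧ Disjoint S ν.support := by
  classical
  set ε : ℝ := 1 / ((k : ℝ) + 1) with hε_def
  have hε : 0 < ε := by positivity
  have hε1 : ε ≤ 1 := by
    rw [hε_def, div_le_one (by positivity)]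
    linarith [(Nat.cast_nonneg k : (0 : ℝ) ≤ k)]
  have hsmall : ∀ T : Finset (Option ℕ), ∀ᶠ n in atTop, ∑ x ∈ T.erase none, |μ n x| < ε :=
    fun T => (hμ.tendsto_sum_abs hfree T).eventually_lt_const hε
  obtain ⟨n, ⟨⟨hnk, hnS⟩, hnorm⟩, hfreq⟩ := ((((eventually_ge_atTop k).and (hsmall S)).and
    (hμ.tendsto_fsNorm_sub.eventually_ge_atTop ((k : ℝ) + 2))).and
    (eventually_frequently_le_add (fun n => abs_nonneg (μ n none)) hε)).exists
  obtain ⟨m, hnm, ⟨hmk, hmS⟩, hmn⟩ := (hfreq.and_eventually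
    (((eventually_ge_atTop k).and (hsmall S)).and (hsmall (μ n).support))).exists
  obtain ⟨c, hc, hcε⟩ := exists_abs_le_one_abs_sub_mul_le hε.le hnm
  set T := insert none S with hT
  have hTS : T.erase none = S.erase none := by simp [hT]
  have hnoneT : none ∈ T := Finset.mem_insert_self _ _
  have hcm : ∀ x, |c * μ m x| ≤ |μ m x| := fun x => by
    rw [abs_mul]
    exact mul_le_of_le_one_left (abs_nonneg _) hc
  set ν : Option ℕ →₀ ℝ := (μ n - c • μ m).filter (· ∉ T) with hν
  have hνT : ∀ x ∈ T, ν x = 0 := fun x hx => Finsupp.filter_apply_neg (· ∉ T) _ (by simpa using hx)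
  have hνx : ∀ x ∉ T, ν x = μ n x - c * μ m x := fun x hx => by
    rw [hν, Finsupp.filter_apply_pos (· ∉ T) _ hx]
    simp
  refine ⟨ν, ⟨?_, n, m, hnk, hmk, fun A => ?_⟩, ?_⟩
  · have h₁ : fsNorm (μ n) - |μ n none| - ε ≤ ∑ x ∈ (μ n).support \ T, |μ n x| := by
      have h₂ : fsNorm (μ n) ≤ ∑ x ∈ ((μ n).support \ T) ∪ T, |μ n x| :=
        (fsNorm_eq_sum_of_subset (by simp)).le
      rw [Finset.sum_union Finset.sdiff_disjoint, ← Finset.add_sum_erase T _ hnoneT, hTS] at h₂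
      linarith
    have h₂ : ∑ x ∈ (μ n).support \ T, |μ m x| ≤ ∑ x ∈ (μ n).support.erase none, |μ m x| := by
      refine Finset.sum_le_sum_of_subset_of_nonneg (fun x hx => ?_) fun _ _ _ => abs_nonneg _
      rw [Finset.mem_sdiff] at hx
      exact Finset.mem_erase.2 ⟨fun h => hx.2 (h ▸ hnoneT), hx.1⟩
    have h₃ : ∑ x ∈ (μ n).support \ T, (|μ n x| - |μ m x|) ≤
        ∑ x ∈ (μ n).support \ T, |ν x| := by
      refine Finset.sum_le_sum fun x hx => ?_
      rw [hνx x (Finset.mem_sdiff.1 hx).2]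
      linarith [abs_sub_abs_le_abs_sub (μ n x) (c * μ m x), hcm x]
    rw [Finset.sum_sub_distrib] at h₃
    linarith [sum_abs_le_fsNorm ν ((μ n).support \ T)]
  · set U := (μ n).support ∪ (μ m).support ∪ ν.support ∪ T with hU
    have hdiff : fsMeas (μ n) A - c * fsMeas (μ m) A - fsMeas ν A =
        ∑ x ∈ T, A.indicator (fun y => μ n y - c * μ m y) x := by
      rw [fsMeas_eq_sum_of_subset (U := U) (μ := μ n) (by grind) A,
        fsMeas_eq_sum_of_subset (U := U) (μ := μ m) (by grind) A,
        fsMeas_eq_sum_of_subset (U := U) (μ := ν) (by grind) A,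
        Finset.mul_sum, ← Finset.sum_sub_distrib, ← Finset.sum_sub_distrib]
      symm
      have hTU : T ⊆ U := by grind
      rw [← Finset.sum_subset hTU]
      · refine Finset.sum_congr rfl fun x hx => ?_
        by_cases hA : x ∈ A <;> simp [hA, hνT x hx]
      · intro x _ hx
        by_cases hA : x ∈ A <;> simp [hA, hνx x hx]
    have hle : |∑ x ∈ T, A.indicator (fun y => μ n y - c * μ m y) x| ≤ 3 * ε := by
      calc |∑ x ∈ T, A.indicator (fun y => μ n y - c * μ m y) x|
          ≤ ∑ x ∈ T, |μ n x - c * μ m x| := by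
            refine (Finset.abs_sum_le_sum_abs _ _).trans (Finset.sum_le_sum fun x _ => ?_)
            by_cases hA : x ∈ A <;> simp [hA]
        _ = |μ n none - c * μ m none| + ∑ x ∈ S.erase none, |μ n x - c * μ m x| := by
            rw [← Finset.add_sum_erase T _ hnoneT, hTS]
        _ ≤ |μ n none - c * μ m none| + ∑ x ∈ S.erase none, (|μ n x| + |μ m x|) := by
            gcongr with x _
            linarith [abs_sub (μ n x) (c * μ m x), hcm x]
        _ ≤ 3 * ε := by
            rw [Finset.sum_add_distrib]
            linarith
    rw [← hdiff] at hle
    have hcA : |c * fsMeas (μ m) A| ≤ |fsMeas (μ m) A| := by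
      rw [abs_mul]
      exact mul_le_of_le_one_left (abs_nonneg _) hc
    rw [abs_le] at hle hcA ⊢
    constructor <;> linarith [neg_abs_le (fsMeas (μ n) A), le_abs_self (fsMeas (μ n) A)]
  · rw [Finset.disjoint_left]
    intro x hx hxν
    exact Finsupp.mem_support_iff.1 hxν (hνT x (Finset.mem_insert_of_mem hx))

theorem IsANSeq.of_isControlled {F : Filter ℕ} {μ ν : ℕ → (Option ℕ →₀ ℝ)} (hμ : IsANSeq F μ)
    {k : ℕ → ℕ} (hk : Tendsto k atTop atTop) (hν : ∀ i, IsControlled μ (k i) (ν i)) :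
    IsANSeq F ν := by
  choose hnorm n m hn hm hA using hν
  refine ⟨tendsto_atTop_mono hnorm (tendsto_natCast_atTop_atTop.comp hk), fun A hclopen => ?_⟩
  have hlim : Tendsto (fun i => |fsMeas (μ i) A|) atTop (𝓝 0) := by
    simpa using (hμ.2 A hclopen).abs
  refine squeeze_zero_norm (fun i => hA i A) ?_
  have h := ((hlim.comp (tendsto_atTop_mono hn hk)).add
    (hlim.comp (tendsto_atTop_mono hm hk))).add
    ((tendsto_one_div_add_atTop_nhds_zero_nat.comp hk).const_mul (3 : ℝ))
  simpa using h


/-- Proposition `prop_disjoint`. If a free filter `F` does not have the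
Nikodym property, then there is a disjointly supported anti-Nikodym sequence on `N_F`. -/
theorem exists_disjointly_supported_AN_sequence (F : Filter ℕ)
    (hfree : F ≤ Filter.cofinite) (hne : F.NeBot)
    (h : ¬ HasNikodymProp F) :
    ∃ μ : ℕ → (Option ℕ →₀ ℝ), IsANSeq F μ ∧
      ∀ k l, k ≠ l → Disjoint (μ k).support (μ l).support := by
  classical
  obtain ⟨μ, hμ⟩ := not_not.1 h
  let r : ℕ × (Option ℕ →₀ ℝ) → ℕ × (Option ℕ →₀ ℝ) → Prop :=
    fun a b => a.1 ≠ b.1 ∧ Disjoint a.2.support b.2.support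
  have : Std.Symm r := ⟨fun _ _ hab => ⟨hab.1.symm, hab.2.symm⟩⟩
  obtain ⟨f, hf, hfr⟩ := exists_seq_of_forall_finset_exists' (fun a => IsControlled μ a.1 a.2) r
    fun s _ => by
      obtain ⟨k, hk⟩ := Infinite.exists_notMem_finset (s.image Prod.fst)
      obtain ⟨ν, hν, hdisj⟩ :=
        hμ.exists_isControlled_disjoint hfree k (s.biUnion fun a => a.2.support)
      rw [Finset.disjoint_biUnion_left] at hdisj
      exact ⟨(k, ν), hν, fun a ha =>
        ⟨fun hak => hk (Finset.mem_image.2 ⟨a, ha, hak⟩), hdisj a ha⟩⟩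
  have hinj : Function.Injective fun i => (f i).1 := fun i j hij => by
    by_contra hne'
    exact (hfr hne').1 hij
  exact ⟨fun i => (f i).2, hμ.of_isControlled hinj.nat_tendsto_atTop hf,
    fun i j hij => (hfr hij).2⟩
end

section
/- Let F be a free filter on ω and (μ_n) a sequence of finitely supported signed measures on N_F. Then (μ_n) is an anti-Nikodym sequence on N_F if and only if the following three conditions hold simultaneously: (1) ‖μ_n‖ → ∞; (2) μ_n(N_F) → 0; (3) ‖μ_n ↾ (ℕ ∖ A)‖ → 0 for every A ∈ F. -/
open Filter Topology Set MeasureTheory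
open scoped ENNReal NNReal

section FinitelySupportedMeasures

variable (μ : Option ℕ →₀ ℝ)

theorem fsMeas_union {A B : Set (Option ℕ)} (h : Disjoint A B) :
    fsMeas μ (A ∪ B) = fsMeas μ A + fsMeas μ B := by
  simp only [fsMeas, ← Finset.sum_add_distrib, Set.indicator_union_of_disjoint h]

theorem fsMeas_singleton (x : Option ℕ) : fsMeas μ {x} = μ x := by
  classical
  simp only [fsMeas, Set.indicator_apply, Set.mem_singleton_iff]
  simp +contextual [Finset.sum_ite_eq']

theorem fsRestrNorm_union_le (A B : Set (Option ℕ)) :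
    fsRestrNorm μ (A ∪ B) ≤ fsRestrNorm μ A + fsRestrNorm μ B := by
  classical
  simp only [fsRestrNorm, ← Finset.sum_add_distrib]
  refine Finset.sum_le_sum fun x _ => ?_
  have := abs_nonneg (μ x)
  by_cases hA : x ∈ A <;> by_cases hB : x ∈ B <;> simp [hA, hB]

theorem fsRestrNorm_nonneg (A : Set (Option ℕ)) : 0 ≤ fsRestrNorm μ A :=
  Finset.sum_nonneg fun x _ => Set.indicator_nonneg (fun _ _ => abs_nonneg _) x

theorem abs_fsMeas_le_fsRestrNorm (A : Set (Option ℕ)) :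
    |fsMeas μ A| ≤ fsRestrNorm μ A := by
  refine (Finset.abs_sum_le_sum_abs _ _).trans (Finset.sum_le_sum fun x _ => ?_)
  by_cases hA : x ∈ A <;> simp [hA]

theorem fsRestrNorm_eq_fsMeas_sub (A : Set (Option ℕ)) :
    fsRestrNorm μ A = fsMeas μ (A ∩ {x | 0 ≤ μ x}) - fsMeas μ (A ∩ {x | μ x < 0}) := by
  simp only [fsMeas, fsRestrNorm, ← Finset.sum_sub_distrib]
  refine Finset.sum_congr rfl fun x _ => ?_
  by_cases hA : x ∈ A
  · rcases le_or_gt 0 (μ x) with h | h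
    · simp [hA, h, abs_of_nonneg h, not_lt.2 h]
    · simp [hA, h, abs_of_neg h, not_le.2 h]
  · simp [hA]

theorem fsRestrNorm_inter_coe_le (I : Finset (Option ℕ)) (B : Set (Option ℕ)) :
    fsRestrNorm μ (B ∩ I) ≤ ∑ x ∈ I, B.indicator (fun y => |μ y|) x := by
  classical
  rw [fsRestrNorm, Set.inter_comm]
  simp only [← Set.indicator_indicator, Set.indicator_apply (I : Set (Option ℕ)),
    Finset.mem_coe]
  rw [← Finset.sum_filter]
  refine Finset.sum_le_sum_of_subset_of_nonneg (fun x hx => (Finset.mem_filter.1 hx).2)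
    fun x _ _ => Set.indicator_nonneg (fun _ _ => abs_nonneg _) x

theorem continuous_fsMeas_inter (B : Set (Option ℕ)) :
    Continuous fun f : Option ℕ → Bool => fsMeas μ ({x | f x = true} ∩ B) := by
  classical
  unfold fsMeas
  refine continuous_finsetSum _ fun x _ => ?_
  have : (fun f : Option ℕ → Bool => ({x | f x = true} ∩ B).indicator (fun y => μ y) x) =
      (fun b : Bool => if b = true ∧ x ∈ B then μ x else 0) ∘ fun f => f x := by
    funext f
    simp [Set.indicator_apply]
  rw [this]
  exact continuous_of_discreteTopology.comp (continuous_apply x)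

end FinitelySupportedMeasures

/-- If `μ_n(C) → 0` for every `C ⊆ B`, then smallness is eventually uniform over the
subsets of `B` that avoid some finite set; the proof is a Baire category argument in the Cantor cube. -/
theorem exists_finset_abs_fsMeas_le {μ : ℕ → (Option ℕ →₀ ℝ)} {B : Set (Option ℕ)}
    (h : ∀ C ⊆ B, Tendsto (fun n => fsMeas (μ n) C) atTop (𝓝 0)) {ε : ℝ} (hε : 0 < ε) :
    ∃ (I : Finset (Option ℕ)) (m : ℕ), ∀ n ≥ m, ∀ D ⊆ B, Disjoint D (I : Set (Option ℕ)) →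
      |fsMeas (μ n) D| ≤ 2 * ε := by
  classical
  let E : ℕ → Set (Option ℕ → Bool) := fun m =>
    ⋂ n ≥ m, {f | |fsMeas (μ n) ({x | f x = true} ∩ B)| ≤ ε}
  have hclosed : ∀ m, IsClosed (E m) := fun m =>
    isClosed_biInter fun n _ =>
      isClosed_le (continuous_fsMeas_inter (μ n) B).abs continuous_const
  have hcover : ⋃ m, E m = Set.univ := by
    refine Set.eq_univ_of_forall fun f => ?_
    have hf := (h ({x | f x = true} ∩ B) Set.inter_subset_right).abs
    rw [abs_zero] at hf
    obtain ⟨m, hm⟩ := eventually_atTop.1 (hf.eventually_le_const hε)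
    exact Set.mem_iUnion.2 ⟨m, Set.mem_iInter₂.2 hm⟩
  obtain ⟨m, f₀, hf₀⟩ := nonempty_interior_of_iUnion_of_closed hclosed hcover
  obtain ⟨I, u, hu, hsub⟩ := isOpen_pi_iff.1 isOpen_interior f₀ hf₀
  refine ⟨I, m, fun n hn D hD hDI => ?_⟩
  have key : ∀ C ⊆ B, (∀ x ∈ I, x ∈ B → (x ∈ C ↔ f₀ x = true)) →
      |fsMeas (μ n) C| ≤ ε := by
    intro C hC hCI
    have hmem : (fun x => if x ∈ I then f₀ x else decide (x ∈ C)) ∈ E m :=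
      interior_subset (hsub fun x hx => by
        simpa [Finset.mem_coe.1 hx] using (hu x hx).2)
    have hCB : {x | (if x ∈ I then f₀ x else decide (x ∈ C)) = true} ∩ B = C := by
      ext x
      have := @hC x
      have := hCI x
      by_cases hx : x ∈ I <;> simp [hx] <;> tauto
    have hle : |fsMeas (μ n) (_ ∩ B)| ≤ ε := Set.mem_iInter₂.1 hmem n hn
    rwa [hCB] at hle
  let C₀ : Set (Option ℕ) := {x | x ∈ I ∧ x ∈ B ∧ f₀ x = true}
  have h₁ := key C₀ (fun x hx => hx.2.1) fun x hx hxB => by simp [C₀, hx, hxB]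
  have h₂ := key (C₀ ∪ D) (Set.union_subset (fun x hx => hx.2.1) hD) fun x hx hxB => by
    have : x ∉ D := fun hxD => Set.disjoint_left.1 hDI hxD hx
    simp [C₀, hx, hxB, this]
  rw [fsMeas_union (μ n) (Set.disjoint_left.2 fun x hx hxD =>
    Set.disjoint_left.1 hDI hxD hx.1)] at h₂
  rw [abs_le] at *
  constructor <;> linarith

/-- A form of Schur's theorem: setwise convergence to `0` on all subsets of `B` implies
convergence to `0` of the variations on `B`. -/
theorem tendsto_fsRestrNorm_of_forall_subset {μ : ℕ → (Option ℕ →₀ ℝ)} {B : Set (Option ℕ)}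
    (h : ∀ C ⊆ B, Tendsto (fun n => fsMeas (μ n) C) atTop (𝓝 0)) :
    Tendsto (fun n => fsRestrNorm (μ n) B) atTop (𝓝 0) := by
  have hpt : ∀ x, Tendsto (fun n => B.indicator (fun y => |μ n y|) x) atTop (𝓝 0) := by
    intro x
    by_cases hx : x ∈ B
    · simpa [hx, fsMeas_singleton] using (h {x} (Set.singleton_subset_iff.2 hx)).abs
    · simp [hx]
  refine tendsto_order.2 ⟨fun a ha => .of_forall fun n =>
    ha.trans_le (fsRestrNorm_nonneg _ _), fun a ha => ?_⟩
  obtain ⟨I, m, hI⟩ := exists_finset_abs_fsMeas_le h (ε := a / 8) (by positivity)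
  have hsum : Tendsto (fun n => ∑ x ∈ I, B.indicator (fun y => |μ n y|) x) atTop (𝓝 0) := by
    simpa using tendsto_finsetSum I fun x _ => hpt x
  filter_upwards [hsum.eventually_lt_const (half_pos ha), eventually_ge_atTop m] with n hn hmn
  have hdiff : ∀ S : Set (Option ℕ), |fsMeas (μ n) ((B \ I) ∩ S)| ≤ 2 * (a / 8) := fun S =>
    hI n hmn _ (Set.inter_subset_left.trans Set.sdiff_subset)
      (Set.disjoint_sdiff_left.mono_left Set.inter_subset_left)
  have h₁ := (abs_le.1 (hdiff {x | 0 ≤ μ n x})).2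
  have h₂ := (abs_le.1 (hdiff {x | μ n x < 0})).1
  have h₃ := fsRestrNorm_union_le (μ n) (B ∩ I) (B \ I)
  rw [Set.inter_union_sdiff, fsRestrNorm_eq_fsMeas_sub (μ n) (B \ I)] at h₃
  have h₄ := fsRestrNorm_inter_coe_le (μ n) I B
  linarith

theorem isClopen_NFTop_of_none_notMem {F : Filter ℕ} {C : Set (Option ℕ)} (h : none ∉ C) :
    @IsClopen _ (NFTop F) C ↔ {n : ℕ | some n ∉ C} ∈ F :=
  letI := NFTop F
  ⟨fun hC => hC.compl.isOpen h, fun hC => ⟨⟨fun _ => hC⟩, fun h' => absurd h' h⟩⟩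

/-- Proposition `prop_characterization`. A sequence `(μ_n)` of finitely
supported signed measures on `N_F` is anti-Nikodym iff `‖μ_n‖ → ∞`, `μ_n(N_F) → 0`, and
`‖μ_n ↾ (ℕ ∖ A)‖ → 0` for every `A ∈ F`. -/
theorem isANSeq_iff (F : Filter ℕ)
    (hfree : F ≤ Filter.cofinite) (hne : F.NeBot)
    (μ : ℕ → (Option ℕ →₀ ℝ)) :
    IsANSeq F μ ↔
      Tendsto (fun n => fsNorm (μ n)) atTop atTop ∧
      Tendsto (fun n => fsMeas (μ n) Set.univ) atTop (nhds 0) ∧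
      ∀ A ∈ F, Tendsto (fun n => fsRestrNorm (μ n) (Option.some '' Aᶜ)) atTop (nhds 0) := by
  let := NFTop F
  refine and_congr_right fun _ => ⟨fun h => ⟨h _ isClopen_univ, fun A hA => ?_⟩, ?_⟩
  · refine tendsto_fsRestrNorm_of_forall_subset fun C hC => h C ?_
    refine (isClopen_NFTop_of_none_notMem fun h' => ?_).2 (mem_of_superset hA fun n hn h' => ?_)
    · simpa using hC h'
    · simpa [hn] using hC h'
  · rintro ⟨huniv, hF⟩
    have hnone : ∀ A : Set (Option ℕ), none ∉ A → IsClopen A →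
        Tendsto (fun n => fsMeas (μ n) A) atTop (𝓝 0) := by
      intro A hA hAc
      have hA' : some '' {n : ℕ | some n ∉ A}ᶜ = A := by
        ext (_ | x) <;> simp [hA]
      have := hF _ ((isClopen_NFTop_of_none_notMem hA).1 hAc)
      rw [hA'] at this
      exact squeeze_zero_norm (fun n => abs_fsMeas_le_fsRestrNorm (μ n) A) this
    intro A hA
    by_cases hmem : none ∈ A
    · have hsub := huniv.sub (hnone Aᶜ (fun h => h hmem) hA.compl)
      rw [sub_zero] at hsub
      refine hsub.congr fun n => ?_
      rw [← Set.union_compl_self A, fsMeas_union (μ n) disjoint_compl_right, add_sub_cancel_right]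
    · exact hnone A hmem hA
end

section
/- Let F be a free filter on ω. The following are equivalent: (1) F does not have the Nikodym property; (2) there is a density submeasure φ on ω such that φ(ℕ) = ∞ and F ≤_K Exh(φ)*; (3) there is a non-pathological lower semicontinuous submeasure φ on ω such that φ(ℕ) = ∞ and F ≤_K Exh(φ)*. -/
open Filter Topology Set MeasureTheory
open scoped ENNReal NNReal

theorem natMeas_eq_sum (μ : ℕ →₀ ℝ) (A : Set ℕ) {s : Finset ℕ} (hs : μ.support ⊆ s) :
    natMeas μ A = ∑ x ∈ s, A.indicator (fun y => μ y) x := by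
  refine Finset.sum_subset hs fun x _ hx => ?_
  simp [Finsupp.notMem_support_iff.mp hx]

theorem natMeas_mono {μ : ℕ →₀ ℝ} (hμ : ∀ x, 0 ≤ μ x) {A B : Set ℕ} (h : A ⊆ B) :
    natMeas μ A ≤ natMeas μ B :=
  Finset.sum_le_sum fun x _ => Set.indicator_le_indicator_of_subset h hμ x

theorem natMeas_union {A B : Set ℕ} (μ : ℕ →₀ ℝ) (h : Disjoint A B) :
    natMeas μ (A ∪ B) = natMeas μ A + natMeas μ B := by
  simp only [natMeas, Set.indicator_union_of_disjoint h, Finset.sum_add_distrib]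

theorem natMeas_union_le {μ : ℕ →₀ ℝ} (hμ : ∀ x, 0 ≤ μ x) (A B : Set ℕ) :
    natMeas μ (A ∪ B) ≤ natMeas μ A + natMeas μ B := by
  rw [← Set.union_sdiff_self, natMeas_union μ Set.disjoint_sdiff_right]
  gcongr
  exact natMeas_mono hμ Set.sdiff_subset

theorem natMeas_nonneg {μ : ℕ →₀ ℝ} (hμ : ∀ x, 0 ≤ μ x) (A : Set ℕ) : 0 ≤ natMeas μ A :=
  Finset.sum_nonneg fun x _ => Set.indicator_nonneg (fun y _ => hμ y) x

theorem natMeas_empty (μ : ℕ →₀ ℝ) : natMeas μ ∅ = 0 := by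
  simp [natMeas]

theorem natMeas_singleton (μ : ℕ →₀ ℝ) (x : ℕ) : natMeas μ {x} = μ x := by
  rw [natMeas_eq_sum μ {x} (Finset.subset_insert x _), Finset.sum_eq_single x]
  · simp
  · intro y _ hy
    simp [hy]
  · simp

theorem natMeas_congr (μ : ℕ →₀ ℝ) {A B : Set ℕ} (h : ∀ x ∈ μ.support, x ∈ A ↔ x ∈ B) :
    natMeas μ A = natMeas μ B :=
  Finset.sum_congr rfl fun x hx => by
    by_cases hA : x ∈ A
    · simp [hA, (h x hx).mp hA]
    · simp [hA, mt (h x hx).mpr hA]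

theorem abs_natMeas_abs_le {μ : ℕ →₀ ℝ} {A : Set ℕ} {c : ℝ}
    (h : ∀ C ⊆ A, |natMeas μ C| ≤ c) :
    natMeas (μ.mapRange abs abs_zero) A ≤ 2 * c := by
  have hsupp : (μ.mapRange abs abs_zero).support ⊆ μ.support := Finsupp.support_mapRange
  have key : natMeas (μ.mapRange abs abs_zero) A =
      natMeas μ (A ∩ {x | 0 ≤ μ x}) - natMeas μ (A ∩ {x | μ x < 0}) := by
    rw [natMeas_eq_sum _ _ hsupp, natMeas, natMeas, ← Finset.sum_sub_distrib]
    refine Finset.sum_congr rfl fun x _ => ?_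
    by_cases hA : x ∈ A
    · rcases le_or_gt 0 (μ x) with hx | hx
      · simp [hA, hx, abs_of_nonneg hx]
      · simp [hA, hx, abs_of_neg hx]
    · simp [hA]
  have h1 := abs_le.mp (h (A ∩ {x | 0 ≤ μ x}) Set.inter_subset_left)
  have h2 := abs_le.mp (h (A ∩ {x | μ x < 0}) Set.inter_subset_left)
  linarith

theorem continuous_natMeas_setOf (μ : ℕ →₀ ℝ) (A : Set ℕ) :
    Continuous fun b : ℕ → Bool => natMeas μ (A ∩ {x | b x = true}) := by
  classical
  unfold natMeas
  refine continuous_finsetSum _ fun x _ => ?_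
  have : (fun b : ℕ → Bool => (A ∩ {x | b x = true}).indicator (fun y => μ y) x) =
      (fun c : Bool => if x ∈ A ∧ c = true then μ x else 0) ∘ fun b => b x := by
    ext b
    simp [Set.indicator_apply]
  rw [this]
  exact continuous_of_discreteTopology.comp (continuous_apply x)

/-- Schur's theorem for finitely supported measures on a set `A ⊆ ℕ`: convergence to `0` on every
subset of `A` implies convergence of the variations on `A`. -/
theorem tendsto_natMeas_abs {a : ℕ → (ℕ →₀ ℝ)} {A : Set ℕ}
    (h : ∀ C ⊆ A, Tendsto (fun n => natMeas (a n) C) atTop (𝓝 0)) :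
    Tendsto (fun n => natMeas ((a n).mapRange abs abs_zero) A) atTop (𝓝 0) := by
  have hnn : ∀ n x, 0 ≤ (a n).mapRange abs abs_zero x := fun n x => by simp
  rw [Metric.tendsto_atTop]
  intro δ hδ
  obtain ⟨ε, hε, hεδ⟩ : ∃ ε : ℝ, 0 < ε ∧ 5 * ε < δ := ⟨δ / 6, by positivity, by linarith⟩
  let E : ℕ → Set (ℕ → Bool) := fun N =>
    ⋂ n ≥ N, {b | |natMeas (a n) (A ∩ {x | b x = true})| ≤ ε}
  have hclosed : ∀ N, IsClosed (E N) := fun N => isClosed_biInter fun n _ =>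
    isClosed_le (continuous_natMeas_setOf (a n) A).abs continuous_const
  have hunion : ⋃ N, E N = Set.univ := by
    refine Set.eq_univ_of_forall fun b => ?_
    obtain ⟨N, hN⟩ := Metric.tendsto_atTop.mp (h (A ∩ {x | b x = true}) Set.inter_subset_left) ε hε
    refine Set.mem_iUnion.mpr ⟨N, Set.mem_iInter₂.mpr fun n hn => ?_⟩
    simpa using (hN n hn).le
  obtain ⟨N, b₀, hb₀⟩ := nonempty_interior_of_iUnion_of_closed hclosed hunion
  obtain ⟨s, u, hu, hsub⟩ := isOpen_pi_iff.mp isOpen_interior b₀ hb₀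
  have hE : ∀ b : ℕ → Bool, (∀ x ∈ s, b x = b₀ x) → ∀ n ≥ N,
      |natMeas (a n) (A ∩ {x | b x = true})| ≤ ε := by
    intro b hb n hn
    have hmem : b ∈ E N := interior_subset (hsub fun x hx => by
      rw [hb x hx]
      exact (hu x hx).2)
    exact Set.mem_iInter₂.mp hmem n hn
  have htail : ∀ n ≥ N, ∀ C ⊆ A \ ↑s, |natMeas (a n) C| ≤ 2 * ε := by
    classical
    intro n hn C hC
    have h1 := hE (fun x => decide ((x ∈ s ∧ b₀ x = true) ∨ x ∈ C))
      (fun x hx => by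
        have : x ∉ C := fun hxC => (hC hxC).2 hx
        simp [hx, this]) n hn
    have h2 := hE (fun x => decide (x ∈ s ∧ b₀ x = true)) (fun x hx => by simp [hx]) n hn
    have hsplit : A ∩ {x | decide ((x ∈ s ∧ b₀ x = true) ∨ x ∈ C) = true} =
        (A ∩ {x | decide (x ∈ s ∧ b₀ x = true) = true}) ∪ C := by
      ext x
      have : x ∈ C → x ∈ A := fun hx => (hC hx).1
      simp only [decide_eq_true_eq, Set.mem_inter_iff, Set.mem_ofPred_eq, Set.mem_union]
      tauto
    have hdisj : Disjoint (A ∩ {x | decide (x ∈ s ∧ b₀ x = true) = true}) C := by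
      rw [Set.disjoint_left]
      rintro x ⟨_, hx⟩ hxC
      exact (hC hxC).2 (of_decide_eq_true hx).1
    rw [hsplit, natMeas_union _ hdisj] at h1
    rw [abs_le] at h1 h2 ⊢
    constructor <;> linarith [h1.1, h1.2, h2.1, h2.2]
  have hhead : Tendsto (fun n => natMeas ((a n).mapRange abs abs_zero) (A ∩ ↑s)) atTop (𝓝 0) := by
    have heq : ∀ n, natMeas ((a n).mapRange abs abs_zero) (A ∩ ↑s) =
        ∑ x ∈ s, A.indicator (fun y => |natMeas (a n) {y}|) x := by
      intro n
      classical
      rw [natMeas_eq_sum _ _ (Finset.subset_union_right (s₁ := s)),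
        ← Finset.sum_subset Finset.subset_union_left]
      · refine Finset.sum_congr rfl fun x hx => ?_
        simp [Set.indicator_apply, hx, natMeas_singleton]
      · intro x _ hx
        simp [hx]
    simp only [heq]
    rw [← Finset.sum_const_zero (s := s)]
    refine tendsto_finsetSum _ fun x _ => ?_
    by_cases hx : x ∈ A
    · simpa [hx] using (h {x} (by simpa using hx)).abs
    · simp [hx]
  obtain ⟨M, hM⟩ := Metric.tendsto_atTop.mp hhead ε hε
  refine ⟨max N M, fun n hn => ?_⟩
  have h1 := abs_natMeas_abs_le (htail n (le_trans (le_max_left _ _) hn))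
  have h2 := hM n (le_trans (le_max_right _ _) hn)
  have h3 := natMeas_union_le (hnn n) (A ∩ ↑s) (A \ ↑s)
  rw [Set.inter_union_sdiff] at h3
  rw [Real.dist_eq, sub_zero] at h2 ⊢
  rw [abs_of_nonneg (natMeas_nonneg (hnn n) _)] at h2 ⊢
  linarith

theorem fsMeas_eq_linearCombination (μ : Option ℕ →₀ ℝ) (A : Set (Option ℕ)) :
    fsMeas μ A = Finsupp.linearCombination ℝ (A.indicator (1 : Option ℕ → ℝ)) μ := by
  rw [fsMeas, Finsupp.linearCombination_apply, Finsupp.sum]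
  refine Finset.sum_congr rfl fun x _ => ?_
  by_cases hx : x ∈ A <;> simp [hx]

theorem abs_fsMeas_le_fsNorm (μ : Option ℕ →₀ ℝ) (A : Set (Option ℕ)) :
    |fsMeas μ A| ≤ fsNorm μ := by
  refine (Finset.abs_sum_le_sum_abs _ _).trans (Finset.sum_le_sum fun x _ => ?_)
  by_cases hx : x ∈ A <;> simp [hx]

theorem fsMeas_add_compl (μ : Option ℕ →₀ ℝ) (A : Set (Option ℕ)) :
    fsMeas μ A + fsMeas μ Aᶜ = fsMeas μ Set.univ := by
  simp only [fsMeas, ← Finset.sum_add_distrib]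
  refine Finset.sum_congr rfl fun x _ => ?_
  by_cases hx : x ∈ A <;> simp [hx]

theorem fsMeas_image_some (μ : Option ℕ →₀ ℝ) (C : Set ℕ) :
    fsMeas μ (some '' C) = natMeas μ.some C := by
  classical
  have h := Finsupp.sum_option_index μ (fun x r => if x ∈ some '' C then r else 0) (by simp)
    (fun x r₁ r₂ => by by_cases hx : x ∈ some '' C <;> simp [hx])
  simpa [Finsupp.sum, fsMeas, natMeas, Set.indicator_apply] using h

theorem fsMeas_univ_eq (μ : Option ℕ →₀ ℝ) :
    fsMeas μ Set.univ = μ none + natMeas μ.some Set.univ := by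
  have h := Finsupp.sum_option_index μ (fun _ r => r) (by simp) (by simp)
  simpa [Finsupp.sum, fsMeas, natMeas] using h

theorem fsNorm_eq (μ : Option ℕ →₀ ℝ) :
    fsNorm μ = |μ none| + natMeas (μ.some.mapRange abs abs_zero) Set.univ := by
  have h : fsNorm μ = ∑ x ∈ Finset.insertNone μ.some.support, |μ x| := by
    refine Finset.sum_subset (fun x hx => ?_) fun x _ hx => by simpa using hx
    cases x <;> simpa using hx
  rw [h, Finset.sum_insertNone, natMeas_eq_sum _ _ Finsupp.support_mapRange]
  simp

theorem isClopen_NFTop_iff (F : Filter ℕ) (A : Set (Option ℕ)) :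
    @IsClopen _ (NFTop F) A ↔ (none ∈ A → {n | some n ∈ A} ∈ F) ∧
      (none ∉ A → {n | some n ∉ A} ∈ F) := by
  let := NFTop F
  rw [IsClopen, ← isOpen_compl_iff, and_comm]
  rfl

/-- A sequence of nonnegative measures whose masses are unbounded and which tends to `0` on every
complement of a member of `F` yields a density submeasure Katětov-above `F`. -/
theorem exists_density_of_measures (F : Filter ℕ) (ν : ℕ → (ℕ →₀ ℝ)) (hν : ∀ n x, 0 ≤ ν n x)
    (hunb : Tendsto (fun n => natMeas (ν n) Set.univ) atTop atTop)
    (hzero : ∀ B ∈ F, Tendsto (fun n => natMeas (ν n) Bᶜ) atTop (𝓝 0)) :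
    ∃ φ : Submeasure, φ.IsDensity ∧ φ.toFun Set.univ = ⊤ ∧
      ∃ f : ℕ → ℕ, ∀ B ∈ F, (f ⁻¹' B)ᶜ ∈ Exh φ := by
  let e : ℕ → ℕ ↪ ℕ := fun k => ⟨Nat.pair k, fun x y h => (Nat.pair_eq_pair.mp h).2⟩
  have he : ∀ k x, e k x = Nat.pair k x := fun _ _ => rfl
  let l : ℕ → (ℕ →₀ ℝ) := fun k => (ν k).embDomain (e k)
  have hl : ∀ k A, natMeas (l k) A = natMeas (ν k) (e k ⁻¹' A) := by
    intro k A
    simp only [natMeas, l, Finsupp.support_embDomain, Finset.sum_map]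
    refine Finset.sum_congr rfl fun x _ => ?_
    by_cases hx : e k x ∈ A <;> simp [hx]
  have hl0 : ∀ k x, 0 ≤ l k x := by
    intro k x
    rw [← natMeas_singleton, hl]
    exact natMeas_nonneg (hν k) _
  let φ : Submeasure :=
    { toFun := fun A => ⨆ k, ENNReal.ofReal (natMeas (l k) A)
      empty' := by simp [natMeas_empty]
      finite_singleton' := by
        intro n
        refine ne_top_of_le_ne_top (b := ENNReal.ofReal (l n.unpair.1 n)) ENNReal.ofReal_ne_top
          (iSup_le fun k => ?_)
        rw [natMeas_singleton]
        by_cases hk : k = n.unpair.1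
        · rw [hk]
        · have : l k n = 0 := Finsupp.embDomain_of_notMem_range _ _ _ (by
            rintro ⟨x, rfl⟩
            simp [he] at hk)
          simp [this]
      mono' := fun A B h => iSup_mono fun k => ENNReal.ofReal_le_ofReal (natMeas_mono (hl0 k) h)
      subadd' := fun A B => iSup_le fun k =>
        (ENNReal.ofReal_le_ofReal (natMeas_union_le (hl0 k) A B)).trans
          (ENNReal.ofReal_add_le.trans (add_le_add
            (le_iSup (fun k => ENNReal.ofReal (natMeas (l k) A)) k)
            (le_iSup (fun k => ENNReal.ofReal (natMeas (l k) B)) k))) }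
  have hφ : ∀ A, φ.toFun A = ⨆ k, ENNReal.ofReal (natMeas (l k) A) := fun _ => rfl
  refine ⟨φ, ⟨l, hl0, ?_, hφ⟩, ?_, fun n => n.unpair.2, ?_⟩
  · intro m n hmn
    rw [Finset.disjoint_left]
    intro x hx hx'
    simp only [l, Finsupp.support_embDomain, Finset.mem_map] at hx hx'
    obtain ⟨y, _, rfl⟩ := hx
    obtain ⟨z, _, hz⟩ := hx'
    exact hmn (Nat.pair_eq_pair.mp hz).1.symm
  · rw [hφ]
    refine ENNReal.eq_top_of_forall_nnreal_le fun r => ?_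
    obtain ⟨k, hk⟩ := (hunb.eventually_ge_atTop (r : ℝ)).exists
    refine le_trans ?_ (le_iSup _ k)
    rw [hl, Set.preimage_univ, ← ENNReal.ofReal_coe_nnreal]
    exact ENNReal.ofReal_le_ofReal hk
  · intro B hB
    rw [Exh, Set.mem_ofPred_eq, ENNReal.tendsto_nhds_zero]
    intro ε hε
    have hz : Tendsto (fun k => ENNReal.ofReal (natMeas (ν k) Bᶜ)) atTop (𝓝 0) := by
      simpa using ENNReal.tendsto_ofReal (hzero B hB)
    obtain ⟨K, hK⟩ := eventually_atTop.mp (ENNReal.tendsto_nhds_zero.mp hz ε hε)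
    have hfin : ∀ᶠ n in atTop, ∀ k ∈ Finset.range K, ∀ x ∈ (l k).support, x ≤ n := by
      refine (Finset.eventually_all _).mpr fun k _ => (Finset.eventually_all _).mpr fun x _ => ?_
      exact eventually_ge_atTop x
    filter_upwards [hfin] with n hn
    rw [hφ]
    refine iSup_le fun k => ?_
    rcases lt_or_ge k K with hkK | hkK
    · have : natMeas (l k) (((fun n => n.unpair.2) ⁻¹' B)ᶜ \ Set.Iic n) = natMeas (l k) ∅ :=
        natMeas_congr _ fun x hx => by
          simp [hn k (Finset.mem_range.mpr hkK) x hx]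
      simp [this, natMeas_empty]
    · refine le_trans (ENNReal.ofReal_le_ofReal ?_) (hK k hkK)
      rw [hl]
      refine natMeas_mono (hν k) ?_
      rintro x ⟨hx, _⟩
      simpa [he] using hx

theorem exists_density_of_not_hasNikodymProp {F : Filter ℕ} (h : ¬ HasNikodymProp F) :
    ∃ φ : Submeasure, φ.IsDensity ∧ φ.toFun Set.univ = ⊤ ∧
      ∃ f : ℕ → ℕ, ∀ B ∈ F, (f ⁻¹' B)ᶜ ∈ Exh φ := by
  obtain ⟨μ, hnorm, hclopen⟩ := not_not.mp h
  refine exists_density_of_measures F (fun n => (μ n).some.mapRange abs abs_zero)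
    (fun n x => by simp) ?_ ?_
  · have huniv := hclopen Set.univ (@isClopen_univ _ (NFTop F))
    have hlow : ∀ n, (fsNorm (μ n) - |fsMeas (μ n) Set.univ|) / 2 ≤
        natMeas ((μ n).some.mapRange abs abs_zero) Set.univ := by
      intro n
      have h1 := fsNorm_eq (μ n)
      have h2 := fsMeas_univ_eq (μ n)
      have h3 : |natMeas (μ n).some Set.univ| ≤
          natMeas ((μ n).some.mapRange abs abs_zero) Set.univ := by
        rw [natMeas_eq_sum _ _ (Finsupp.support_mapRange (f := abs) (hf := abs_zero))]
        simpa [natMeas] using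
          Finset.abs_sum_le_sum_abs (fun x => (μ n).some x) (μ n).some.support
      have h4 : |μ n none| ≤ |fsMeas (μ n) Set.univ| + |natMeas (μ n).some Set.univ| := by
        have : μ n none = fsMeas (μ n) Set.univ - natMeas (μ n).some Set.univ := by linarith
        rw [this]
        exact abs_sub _ _
      linarith
    refine tendsto_atTop_mono hlow (Tendsto.atTop_div_const two_pos ?_)
    simpa [sub_eq_add_neg] using hnorm.atTop_add huniv.abs.neg
  · intro B hB
    refine tendsto_natMeas_abs fun C hC => ?_
    simp only [← fsMeas_image_some]
    refine hclopen _ ((isClopen_NFTop_iff F _).mpr ⟨by simp, fun _ => ?_⟩)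
    refine mem_of_superset hB fun n hn => ?_
    simpa using fun hnC => hC hnC hn

theorem Submeasure.ne_top_of_finset (φ : Submeasure) (s : Finset ℕ) : φ.toFun ↑s ≠ ⊤ := by
  classical
  induction s using Finset.induction_on with
  | empty => simp [φ.empty']
  | insert a s _ ih =>
    rw [Finset.coe_insert, Set.insert_eq]
    exact ne_top_of_le_ne_top (ENNReal.add_ne_top.mpr ⟨φ.finite_singleton' a, ih⟩)
      (φ.subadd' _ _)

theorem Submeasure.IsDensity.lsc {φ : Submeasure} (h : φ.IsDensity) : φ.LSC := by
  obtain ⟨μ, _, _, hφ⟩ := h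
  intro A
  have hmono : Monotone fun n : ℕ => φ.toFun (A ∩ Set.Iic n) := fun m n hmn =>
    φ.mono' (Set.inter_subset_inter_right _ (Set.Iic_subset_Iic.mpr hmn))
  refine tendsto_order.mpr ⟨fun c hc => ?_, fun c hc => ?_⟩
  · rw [hφ] at hc
    obtain ⟨k, hk⟩ := lt_iSup_iff.mp hc
    have hfin : ∀ᶠ n in atTop, ∀ x ∈ (μ k).support, x ≤ n :=
      (Finset.eventually_all _).mpr fun x _ => eventually_ge_atTop x
    filter_upwards [hfin] with n hn
    rw [hφ]
    refine hk.trans_le (le_iSup_of_le k (le_of_eq ?_))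
    rw [natMeas_congr (μ k) fun x hx => ?_]
    simp [hn x hx]
  · exact Eventually.of_forall fun n => (φ.mono' Set.inter_subset_left).trans_lt hc

theorem Submeasure.IsDensity.nonpathological {φ : Submeasure} (h : φ.IsDensity) :
    φ.Nonpathological := by
  obtain ⟨μ, hμ, _, hφ⟩ := h
  have htsum : ∀ k (B : Set ℕ),
      ∑' n : B, ENNReal.ofReal (μ k n) = ENNReal.ofReal (natMeas (μ k) B) := by
    intro k B
    rw [tsum_subtype B fun n => ENNReal.ofReal (μ k n), tsum_eq_sum (s := (μ k).support),
      natMeas, ENNReal.ofReal_sum_of_nonneg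
        fun x _ => Set.indicator_nonneg (fun y _ => hμ k y) x]
    · refine Finset.sum_congr rfl fun x _ => ?_
      by_cases hx : x ∈ B <;> simp [hx]
    · intro x hx
      simp [Finsupp.notMem_support_iff.mp hx]
  intro A
  refine le_antisymm ?_ (iSup₂_le fun w hw => hw A)
  rw [hφ]
  refine iSup_le fun k => ?_
  rw [← htsum]
  refine le_iSup₂_of_le (fun n => ENNReal.ofReal (μ k n)) (fun B => ?_) le_rfl
  rw [htsum, hφ]
  exact le_iSup (fun k => ENNReal.ofReal (natMeas (μ k) B)) k

theorem Submeasure.exists_measure_Ioc {φ : Submeasure} (hlsc : φ.LSC) (hnp : φ.Nonpathological)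
    (htop : φ.toFun Set.univ = ⊤) (n : ℕ) :
    ∃ (m : ℕ) (w : ℕ → ℝ), (∀ x, 0 ≤ w x) ∧ (n : ℝ) ≤ ∑ x ∈ Finset.Ioc n m, w x ∧
      ∀ s : Finset ℕ, ENNReal.ofReal (∑ x ∈ s, w x) ≤ φ.toFun ↑s := by
  have htail : φ.toFun (Set.univ \ Set.Iic n) = ⊤ := by
    have h := φ.subadd' (Set.Iic n) (Set.univ \ Set.Iic n)
    rw [Set.union_sdiff_cancel (Set.subset_univ _), htop, top_le_iff, ENNReal.add_eq_top] at h
    refine h.resolve_left ?_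
    simpa using φ.ne_top_of_finset (Finset.Iic n)
  have hlim := hlsc (Set.univ \ Set.Iic n)
  rw [htail] at hlim
  obtain ⟨m, hm⟩ := (hlim.eventually_const_lt (ENNReal.natCast_lt_top n)).exists
  have hset : (Set.univ \ Set.Iic n) ∩ Set.Iic m = ↑(Finset.Ioc n m) := by
    ext x
    simp
  rw [hset, hnp] at hm
  obtain ⟨w, hm⟩ := lt_iSup_iff.mp hm
  obtain ⟨hw, hm⟩ := lt_iSup_iff.mp hm
  have hw' : ∀ s : Finset ℕ, ∑ x ∈ s, w x ≤ φ.toFun ↑s := fun s => by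
    rw [← Finset.tsum_subtype]
    exact hw ↑s
  have hfin : ∀ x, w x ≠ ⊤ := fun x =>
    ne_top_of_le_ne_top (φ.ne_top_of_finset {x}) (by simpa using hw' {x})
  have hsum : ∀ s : Finset ℕ, ENNReal.ofReal (∑ x ∈ s, (w x).toReal) = ∑ x ∈ s, w x := by
    intro s
    rw [← ENNReal.toReal_sum fun x _ => hfin x,
      ENNReal.ofReal_toReal (ENNReal.sum_ne_top.mpr fun x _ => hfin x)]
  refine ⟨m, fun x => (w x).toReal, fun x => ENNReal.toReal_nonneg, ?_, fun s => ?_⟩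
  · have h : (n : ℝ≥0∞) ≤ ∑ x ∈ Finset.Ioc n m, w x := by
      rw [← Finset.tsum_subtype]
      exact hm.le
    rw [← hsum, ← ENNReal.ofReal_natCast] at h
    exact (ENNReal.ofReal_le_ofReal_iff
      (Finset.sum_nonneg fun x _ => ENNReal.toReal_nonneg)).mp h
  · rw [hsum]
    exact hw' s

theorem not_hasNikodymProp_of_nonpathological {F : Filter ℕ} {φ : Submeasure} (hlsc : φ.LSC)
    (hnp : φ.Nonpathological) (htop : φ.toFun Set.univ = ⊤) {f : ℕ → ℕ}
    (hf : ∀ B ∈ F, (f ⁻¹' B)ᶜ ∈ Exh φ) : ¬ HasNikodymProp F := by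
  classical
  choose m w hw0 hwn hwφ using Submeasure.exists_measure_Ioc hlsc hnp htop
  let μ : ℕ → (Option ℕ →₀ ℝ) := fun n =>
    ∑ x ∈ Finset.Ioc n (m n), (Finsupp.single (some (f x)) (w n x) - Finsupp.single none (w n x))
  have hμ : ∀ n A, none ∉ A →
      fsMeas (μ n) A = ∑ x ∈ Finset.Ioc n (m n) with some (f x) ∈ A, w n x := by
    intro n A hA
    rw [fsMeas_eq_linearCombination, map_sum, Finset.sum_filter]
    refine Finset.sum_congr rfl fun x _ => ?_
    by_cases hx : some (f x) ∈ A <;> simp [hA, hx]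
  have huniv : ∀ n, fsMeas (μ n) Set.univ = 0 := by
    intro n
    rw [fsMeas_eq_linearCombination, map_sum]
    simp
  have hzero : ∀ A, none ∉ A → {n | some n ∉ A} ∈ F →
      Tendsto (fun n => fsMeas (μ n) A) atTop (𝓝 0) := by
    intro A hA hAF
    have hlim := hf _ hAF
    have hle : ∀ n, ENNReal.ofReal (fsMeas (μ n) A) ≤
        φ.toFun ((f ⁻¹' {n | some n ∉ A})ᶜ \ Set.Iic n) := by
      intro n
      rw [hμ n A hA]
      refine (hwφ n _).trans (φ.mono' fun x hx => ?_)
      simp only [Finset.coe_filter, Finset.mem_Ioc, Set.mem_ofPred_eq] at hx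
      simp [hx.1.1, hx.2]
    have hofReal := tendsto_of_tendsto_of_tendsto_of_le_of_le tendsto_const_nhds hlim
      (fun _ => zero_le) hle
    have := (ENNReal.tendsto_toReal ENNReal.zero_ne_top).comp hofReal
    refine this.congr fun n => ENNReal.toReal_ofReal ?_
    rw [hμ n A hA]
    exact Finset.sum_nonneg fun x _ => hw0 n x
  refine not_not.mpr ⟨μ, ?_, fun A hA => ?_⟩
  · refine tendsto_atTop_mono (fun n => ?_) tendsto_natCast_atTop_atTop
    refine le_trans (le_trans (hwn n) ?_)
      ((le_abs_self _).trans (abs_fsMeas_le_fsNorm (μ n) {none}ᶜ))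
    rw [hμ n _ (by simp)]
    simp
  · rw [isClopen_NFTop_iff] at hA
    by_cases hn : none ∈ A
    · have h := (hzero Aᶜ (by simpa using hn) (by simpa using hA.1 hn)).neg
      rw [neg_zero] at h
      refine h.congr fun n => ?_
      linarith [fsMeas_add_compl (μ n) A, huniv n]
    · exact hzero A hn (hA.2 hn)

/-- Theorem `thm_nikodym_exh`. For a free filter `F` on `ω` the following are
equivalent: (1) `F` does not have the Nikodym property; (2) there is a density submeasure `φ`
with `φ(ℕ) = ∞` and `F ≤_K Exh(φ)*`; (3) there is a non-pathological lsc submeasure `φ` with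
`φ(ℕ) = ∞` and `F ≤_K Exh(φ)*`. -/
theorem not_nikodym_tfae_katetov_exh (F : Filter ℕ)
    (hfree : F ≤ Filter.cofinite) (hne : F.NeBot) :
    List.TFAE
      [ ¬ HasNikodymProp F,
        ∃ φ : Submeasure, φ.IsDensity ∧ φ.toFun Set.univ = ⊤ ∧
          ∃ f : ℕ → ℕ, ∀ B ∈ F, (f ⁻¹' B)ᶜ ∈ Exh φ,
        ∃ φ : Submeasure, φ.LSC ∧ φ.Nonpathological ∧ φ.toFun Set.univ = ⊤ ∧
          ∃ f : ℕ → ℕ, ∀ B ∈ F, (f ⁻¹' B)ᶜ ∈ Exh φ ] := by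
  tfae_have 1 → 2 := exists_density_of_not_hasNikodymProp
  tfae_have 2 → 3 := fun ⟨φ, hφ, h⟩ => ⟨φ, hφ.lsc, hφ.nonpathological, h⟩
  tfae_have 3 → 1 := fun ⟨_, hlsc, hnp, htop, _, hf⟩ =>
    not_hasNikodymProp_of_nonpathological hlsc hnp htop hf
  tfae_finish
end
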